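/- Let G be an almost Moore digraph of degree d > 1 and diameter k > 1, let α > 1 be an integer, and suppose H_α is diregular of degree d'. Then for every vertex u of H_α and every j with 1 ≤ j < k there are exactly d'^j vertices of H_α at distance j from u in G, and there are exactly d'^k − 1 vertices of H_α at distance k from u in G. -/

import Mathlib

/-- `IsWalkFrom A u v l` : the list `u :: l` is a directed walk from `u` to `v`
along the adjacency relation `A`; the length of the walk is `l.length`. -/
def IsWalkFrom {V : Type} (A : V → V → Prop) (u v : V) (l : List V) : Prop :=
  List.Chain A u l ∧ (u :: l).getLast (List.cons_ne_nil u l) = v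

/-- An almost Moore digraph (a `(d,k)`-digraph): a diregular digraph of degree `d > 1`,
diameter `k > 1` and order `d + d² + ⋯ + d^k`, together with its repeat permutation `rep`:
for every vertex `v`, every vertex `w ≠ rep v` is reached from `v` by exactly one walk of
length at most `k`, while `rep v` is reached by exactly two such walks, at least one of
which has length `k`.  The map `rep` is an automorphism of the digraph. -/
structure AlmostMooreDigraph (d k : ℕ) where
  hd : 1 < d
  hk : 1 < k
  V : Type
  [fintypeV : Fintype V]
  [decEqV : DecidableEq V]
  Adj : V → V → Prop
  [adjDec : DecidableRel Adj]
  loopless : ∀ v, ¬ Adj v v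
  out_deg : ∀ v, {w | Adj v w}.ncard = d
  in_deg : ∀ v, {w | Adj w v}.ncard = d
  reach : ∀ u v, ∃ l, IsWalkFrom Adj u v l ∧ l.length ≤ k
  diam : ∃ u v, ∀ l, IsWalkFrom Adj u v l → k ≤ l.length
  card_eq : Fintype.card V = ∑ i ∈ Finset.range k, d ^ (i + 1)
  rep : V → V
  rep_spec : ∀ v w, w ≠ rep v → ∃! l, IsWalkFrom Adj v w l ∧ l.length ≤ k
  rep_two : ∀ v, ∃ l₁ l₂, l₁ ≠ l₂ ∧
      IsWalkFrom Adj v (rep v) l₁ ∧ l₁.length ≤ k ∧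
      IsWalkFrom Adj v (rep v) l₂ ∧ l₂.length ≤ k ∧
      (l₁.length = k ∨ l₂.length = k) ∧
      (∀ l, IsWalkFrom Adj v (rep v) l → l.length ≤ k → l = l₁ ∨ l = l₂)
  rep_bijective : Function.Bijective rep
  rep_adj : ∀ u v, Adj u v ↔ Adj (rep u) (rep v)

attribute [instance] AlmostMooreDigraph.fintypeV AlmostMooreDigraph.decEqV
  AlmostMooreDigraph.adjDec

/-- `ordRep M v` : the smallest `t ≥ 1` with `rep^t v = v`. -/
noncomputable def ordRep {d k : ℕ} (M : AlmostMooreDigraph d k) (v : M.V) : ℕ :=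
  sInf {t | 0 < t ∧ M.rep^[t] v = v}

/-- The vertex set of the subdigraph `H_α`: vertices whose order under the repeat
permutation divides `2^t * α` for some `t ≥ 0`. -/
def Hset {d k : ℕ} (M : AlmostMooreDigraph d k) (α : ℕ) : Set M.V :=
  {v | ∃ t : ℕ, ordRep M v ∣ 2 ^ t * α}

/-- The (walk) distance from `u` to `v` in the digraph: the length of a shortest
directed walk from `u` to `v`. -/
noncomputable def distG {d k : ℕ} (M : AlmostMooreDigraph d k) (u v : M.V) : ℕ :=
  sInf {n | ∃ l : List M.V, IsWalkFrom M.Adj u v l ∧ l.length = n}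

open Function in
theorem ordRep_eq_minimalPeriod {d k : ℕ} (M : AlmostMooreDigraph d k) (v : M.V) :
    ordRep M v = minimalPeriod M.rep v := by
  have hv : v ∈ periodicPts M.rep := M.rep_bijective.injective.mem_periodicPts v
  have hmem : minimalPeriod M.rep v ∈ {t | 0 < t ∧ M.rep^[t] v = v} :=
    ⟨minimalPeriod_pos_of_mem_periodicPts hv, isPeriodicPt_minimalPeriod _ _⟩
  refine le_antisymm (Nat.sInf_le hmem) (le_csInf ⟨_, hmem⟩ ?_)
  rintro t ⟨ht, h⟩
  exact IsPeriodicPt.minimalPeriod_le ht h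

theorem mem_Hset_iff {d k : ℕ} (M : AlmostMooreDigraph d k) (α : ℕ) (v : M.V) :
    v ∈ Hset M α ↔ ∃ t : ℕ, M.rep^[2 ^ t * α] v = v := by
  simp only [Hset, Set.mem_ofPred_eq, ordRep_eq_minimalPeriod,
    ← Function.isPeriodicPt_iff_minimalPeriod_dvd]
  rfl

theorem rep_mem_Hset {d k : ℕ} (M : AlmostMooreDigraph d k) (α : ℕ) {v : M.V}
    (hv : v ∈ Hset M α) : M.rep v ∈ Hset M α := by
  rw [mem_Hset_iff] at hv ⊢
  obtain ⟨t, ht⟩ := hv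
  exact ⟨t, by rw [← Function.iterate_succ_apply, Function.iterate_succ_apply', ht]⟩

theorem IsWalkFrom.map {V : Type} {A : V → V → Prop} {f : V → V}
    (hf : ∀ a b, A a b → A (f a) (f b)) {u v : V} {l : List V} (h : IsWalkFrom A u v l) :
    IsWalkFrom A (f u) (f v) (l.map f) := by
  obtain ⟨h1, h2⟩ := h
  refine ⟨?_, ?_⟩
  · exact List.isChain_map_of_isChain (l := u :: l) f hf h1
  · rw [← h2, ← List.getLast_map (f := f)] <;> simp

theorem IsWalkFrom.end_mem {V : Type} {A : V → V → Prop} {S : Set V} {u v : V} {l : List V}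
    (h : IsWalkFrom A u v l) (hu : u ∈ S) (hl : ∀ x ∈ l, x ∈ S) : v ∈ S := by
  have := List.getLast_mem (List.cons_ne_nil u l)
  rw [h.2, List.mem_cons] at this
  rcases this with rfl | h
  exacts [hu, hl _ h]

theorem rep_iterate_adj {d k : ℕ} (M : AlmostMooreDigraph d k) (n : ℕ) :
    ∀ a b, M.Adj a b → M.Adj (M.rep^[n] a) (M.rep^[n] b) := by
  induction n with
  | zero => exact fun _ _ h => h
  | succ n ih => exact fun a b h => ih _ _ ((M.rep_adj a b).1 h)

/-- Among three short walks with the same ends, two coincide. -/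
theorem short_walks_pigeonhole {d k : ℕ} (M : AlmostMooreDigraph d k) {u v : M.V}
    {a b c : List M.V}
    (ha : IsWalkFrom M.Adj u v a) (hak : a.length ≤ k)
    (hb : IsWalkFrom M.Adj u v b) (hbk : b.length ≤ k)
    (hc : IsWalkFrom M.Adj u v c) (hck : c.length ≤ k) : a = b ∨ b = c ∨ a = c := by
  by_cases h : v = M.rep u
  · subst h
    obtain ⟨l₁, l₂, -, -, -, -, -, -, h⟩ := M.rep_two u
    have h1 := h a ha hak
    have h2 := h b hb hbk
    have h3 := h c hc hck
    grind
  · exact Or.inl ((M.rep_spec u v h).unique ⟨ha, hak⟩ ⟨hb, hbk⟩)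

/-- Short walks between vertices of `H_α` stay inside `H_α`. -/
theorem short_walk_subset_Hset {d k : ℕ} (M : AlmostMooreDigraph d k) (α : ℕ) {u v : M.V}
    (hu : u ∈ Hset M α) (hv : v ∈ Hset M α) {l : List M.V}
    (hl : IsWalkFrom M.Adj u v l) (hlk : l.length ≤ k) : ∀ x ∈ l, x ∈ Hset M α := by
  rw [mem_Hset_iff] at hu hv
  obtain ⟨s, hs⟩ := hu
  obtain ⟨t, ht⟩ := hv
  set m := 2 ^ (s + t) * α with hm
  have hfu : M.rep^[m] u = u :=
    Function.IsPeriodicPt.trans_dvd (m := 2 ^ s * α) hs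
      (mul_dvd_mul_right (pow_dvd_pow 2 (Nat.le_add_right s t)) α)
  have hfv : M.rep^[m] v = v :=
    Function.IsPeriodicPt.trans_dvd (m := 2 ^ t * α) ht
      (mul_dvd_mul_right (pow_dvd_pow 2 (Nat.le_add_left t s)) α)
  set f := M.rep^[m]
  have hinj : Function.Injective (List.map f) :=
    List.map_injective_iff.2 (M.rep_bijective.injective.iterate m)
  have h1 : IsWalkFrom M.Adj u v (l.map f) := by
    have := hl.map (f := f) (rep_iterate_adj M m)
    rwa [hfu, hfv] at this
  have h2 : IsWalkFrom M.Adj u v ((l.map f).map f) := by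
    have := h1.map (f := f) (rep_iterate_adj M m)
    rwa [hfu, hfv] at this
  have key : (l.map f).map f = l := by
    rcases short_walks_pigeonhole M hl hlk h1 (by simpa using hlk) h2 (by simpa using hlk)
      with h | h | h
    · rw [← h, ← h]
    · rw [← h]; exact (hinj h).symm
    · exact h.symm
  intro x hx
  rw [mem_Hset_iff]
  refine ⟨s + t + 1, ?_⟩
  have hx' : f (f x) = x := by
    rw [List.map_map] at key
    exact List.map_inj_left.1 (key.trans l.map_id.symm) x hx
  rw [show 2 ^ (s + t + 1) * α = m + m by rw [hm]; ring, Function.iterate_add_apply]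
  exact hx'

/-- The number of walks of length `n` that stay in a finite out-regular set. -/
theorem ncard_walks_in {V : Type} [Finite V] {A : V → V → Prop} {S : Set V} {e : ℕ}
    (hS : ∀ v ∈ S, {w | w ∈ S ∧ A v w}.ncard = e) (n : ℕ) {u : V} (hu : u ∈ S) :
    {l : List V | List.IsChain A (u :: l) ∧ l.length = n ∧ ∀ x ∈ l, x ∈ S}.ncard = e ^ n := by
  induction n generalizing u with
  | zero =>
    rw [pow_zero, Set.ncard_eq_one]
    refine ⟨[], ?_⟩
    ext l
    cases l <;> simp
  | succ n ih =>
    let W : V → Set (List V) := fun w =>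
      {l | List.IsChain A (w :: l) ∧ l.length = n ∧ ∀ x ∈ l, x ∈ S}
    have hfin : ∀ w, Finite (W w) := fun w =>
      ((List.finite_length_eq V n).subset fun l hl => hl.2.1).to_subtype
    let E : (Σ w : {w | w ∈ S ∧ A u w}, W w) ≃
        {l : List V | List.IsChain A (u :: l) ∧ l.length = n + 1 ∧ ∀ x ∈ l, x ∈ S} :=
      Equiv.ofBijective
        (fun p => ⟨p.1.1 :: p.2.1, by
          obtain ⟨⟨w, hw, huw⟩, ⟨l, hl, hn, hlS⟩⟩ := p
          simp_all⟩) (by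
        constructor
        · rintro ⟨⟨w, hw⟩, ⟨l, hl⟩⟩ ⟨⟨w', hw'⟩, ⟨l', hl'⟩⟩ h
          simp only [Subtype.mk.injEq, List.cons.injEq] at h
          obtain ⟨rfl, rfl⟩ := h
          rfl
        · rintro ⟨_ | ⟨w, l⟩, hc, hn, hlS⟩
          · simp at hn
          · refine ⟨⟨⟨w, ?_⟩, ⟨l, ?_⟩⟩, rfl⟩
            · exact ⟨hlS w List.mem_cons_self, (List.isChain_cons_cons.1 hc).1⟩
            · exact ⟨(List.isChain_cons_cons.1 hc).2, Nat.succ.inj hn,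
                fun x hx => hlS x (List.mem_cons_of_mem w hx)⟩)
    have := Fintype.ofFinite {w | w ∈ S ∧ A u w}
    have hcard : ∀ w : {w | w ∈ S ∧ A u w}, Nat.card (W w) = e ^ n := fun w =>
      (Nat.card_coe_set_eq (W w)).trans (ih w.2.1)
    rw [← Nat.card_coe_set_eq, ← Nat.card_congr E, Nat.card_sigma,
      Finset.sum_congr rfl (fun w _ => hcard w), Finset.sum_const, Finset.card_univ, ← Nat.card_eq_fintype_card, Nat.card_coe_set_eq,
      hS u hu, smul_eq_mul, pow_succ']

/-- After removing one walk of length `k` from `u` to its repeat, every vertex is reached by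
a unique short walk, and the length of that walk is the distance. -/
theorem exists_removable_walk {d k : ℕ} (M : AlmostMooreDigraph d k) (u : M.V) :
    ∃ l₀, IsWalkFrom M.Adj u (M.rep u) l₀ ∧ l₀.length = k ∧
      ∀ v, ∃ l, IsWalkFrom M.Adj u v l ∧ l.length ≤ k ∧ l ≠ l₀ ∧ distG M u v = l.length ∧
        ∀ l', IsWalkFrom M.Adj u v l' → l'.length ≤ k → l' ≠ l₀ → l' = l := by
  obtain ⟨l₀, h₀, hk₀, huniq⟩ : ∃ l₀, IsWalkFrom M.Adj u (M.rep u) l₀ ∧ l₀.length = k ∧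
      ∀ v, ∃ l, IsWalkFrom M.Adj u v l ∧ l.length ≤ k ∧ l ≠ l₀ ∧
        ∀ l', IsWalkFrom M.Adj u v l' → l'.length ≤ k → l' ≠ l₀ → l' = l := by
    obtain ⟨l₁, l₂, hne, h1, h1k, h2, h2k, hor, hall⟩ := M.rep_two u
    have main : ∀ a b, a ≠ b → IsWalkFrom M.Adj u (M.rep u) a → a.length = k →
        IsWalkFrom M.Adj u (M.rep u) b → b.length ≤ k →
        ∀ v, ∃ l, IsWalkFrom M.Adj u v l ∧ l.length ≤ k ∧ l ≠ a ∧
          ∀ l', IsWalkFrom M.Adj u v l' → l'.length ≤ k → l' ≠ a → l' = l := by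
      intro a b hab ha hak hb hbk v
      by_cases hv : v = M.rep u
      · subst hv
        refine ⟨b, hb, hbk, hab.symm, fun l' hl' hlk' hne' => ?_⟩
        rcases short_walks_pigeonhole M hl' hlk' hb hbk ha hak.le with h | h | h
        exacts [h, absurd h.symm hab, absurd h hne']
      · obtain ⟨l, ⟨hl, hlk⟩, hu⟩ := M.rep_spec u v hv
        refine ⟨l, hl, hlk, ?_, fun l' hl' hlk' _ => hu l' ⟨hl', hlk'⟩⟩
        rintro rfl
        exact hv (hl.2.symm.trans ha.2)
    rcases hor with h | h
    · exact ⟨l₁, h1, h, main _ _ hne h1 h h2 h2k⟩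
    · exact ⟨l₂, h2, h, main _ _ hne.symm h2 h h1 h1k⟩
  refine ⟨l₀, h₀, hk₀, fun v => ?_⟩
  obtain ⟨l, hl, hlk, hne, hu⟩ := huniq v
  refine ⟨l, hl, hlk, hne, ?_, hu⟩
  refine le_antisymm (Nat.sInf_le ⟨l, hl, rfl⟩) (le_csInf ⟨_, l, hl, rfl⟩ ?_)
  rintro n ⟨l', hl', rfl⟩
  by_cases h : l' = l₀
  · rw [h, hk₀]; exact hlk
  · rcases le_total l'.length k with hk' | hk'
    · rw [hu l' hl' hk' h]
    · exact hlk.trans hk'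

/-- Suppose `H_α` is diregular of degree `d'`.  Then for every vertex
`u` of `H_α` there are exactly `d'^j` vertices of `H_α` at distance `j` from `u` in `G`
for each `1 ≤ j < k`, and exactly `d'^k − 1` vertices of `H_α` at distance `k` from `u`
in `G`. -/
theorem stmt5 {d k : ℕ} (M : AlmostMooreDigraph d k) (α : ℕ) (hα : 1 < α) (d' : ℕ)
    (hreg : ∀ v ∈ Hset M α,
      {w | w ∈ Hset M α ∧ M.Adj v w}.ncard = d' ∧
      {w | w ∈ Hset M α ∧ M.Adj w v}.ncard = d') :
    ∀ u ∈ Hset M α,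
      (∀ j : ℕ, 1 ≤ j → j < k →
        {v | v ∈ Hset M α ∧ distG M u v = j}.ncard = d' ^ j) ∧
      {v | v ∈ Hset M α ∧ distG M u v = k}.ncard = d' ^ k - 1 := by
  intro u hu
  obtain ⟨l₀, h₀, hk₀, huniq⟩ := exists_removable_walk M u
  let W : ℕ → Set (List M.V) := fun j =>
    {l | List.IsChain M.Adj (u :: l) ∧ l.length = j ∧ ∀ x ∈ l, x ∈ Hset M α}
  have hW : ∀ j, (W j).ncard = d' ^ j := fun j =>
    ncard_walks_in (fun v hv => (hreg v hv).1) j hu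
  let last : List M.V → M.V := fun l => (u :: l).getLast (List.cons_ne_nil u l)
  have hsphere : ∀ j ≤ k,
      {v | v ∈ Hset M α ∧ distG M u v = j}.ncard = (W j \ {l₀}).ncard := by
    intro j hj
    have himage : {v | v ∈ Hset M α ∧ distG M u v = j} = last '' (W j \ {l₀}) := by
      ext v
      obtain ⟨l, hl, hlk, hne, hdist, hu'⟩ := huniq v
      constructor
      · rintro ⟨hv, rfl⟩
        exact ⟨l, ⟨⟨hl.1, hdist.symm, short_walk_subset_Hset M α hu hv hl hlk⟩, hne⟩, hl.2⟩
      · rintro ⟨l', ⟨⟨hc, rfl, hS⟩, hne'⟩, hlast⟩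
        have hl' : IsWalkFrom M.Adj u v l' := ⟨hc, hlast⟩
        refine ⟨hl'.end_mem hu hS, ?_⟩
        rw [hdist, hu' l' hl' hj hne']
    rw [himage, Set.InjOn.ncard_image]
    rintro a ⟨⟨hac, haj, -⟩, hane⟩ b ⟨⟨hbc, hbj, -⟩, hbne⟩ hab
    obtain ⟨l, -, -, -, -, hu'⟩ := huniq (last b)
    rw [hu' a ⟨hac, hab⟩ (haj.trans_le hj) hane, hu' b ⟨hbc, rfl⟩ (hbj.trans_le hj) hbne]
  refine ⟨fun j _ hj => ?_, ?_⟩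
  · rw [hsphere j hj.le, Set.sdiff_singleton_eq_self, hW]
    rintro ⟨-, h, -⟩
    exact hj.ne (h.symm.trans hk₀)
  · rw [hsphere k le_rfl, Set.ncard_sdiff_singleton_of_mem, hW]
    exact ⟨h₀.1, hk₀, short_walk_subset_Hset M α hu (rep_mem_Hset M α hu) h₀ hk₀.le⟩
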